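/- Upper bound on God's Number for the n×n×1 Rubik's Cube: there is a constant C > 0 such that for every n ≥ 2 and every g ∈ G(n), there exist a natural number k ≤ C·n²/log n and moves m₁, …, m_k ∈ S(n) such that c₀ ∘ (m_k ⋯ m₁ g)⁻¹ = c₀; that is, every reachable configuration of the n×n×1 Rubik's Cube can be solved in O(n²/log n) moves in this model. -/

import Mathlib

/-- Sticker positions of the `n × n × 1` Rubik's Cube. -/
abbrev RPos (n : ℕ) := Fin n × Fin n × Bool

/-- Underlying function of the row move `ρ i`. -/
def rowMoveFun (n : ℕ) (i : Fin n) : RPos n → RPos n :=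
  fun p => if p.2.1 = i then (p.1.rev, p.2.1, !p.2.2) else p

theorem rowMoveFun_involutive (n : ℕ) (i : Fin n) :
    Function.Involutive (rowMoveFun n i) := by
  rintro ⟨x, y, b⟩
  by_cases h : y = i <;> simp [rowMoveFun, h]

/-- The row move `ρ i`. -/
def rowMove (n : ℕ) (i : Fin n) : Equiv.Perm (RPos n) :=
  (rowMoveFun_involutive n i).toPerm _

/-- Underlying function of the column move `σ j`. -/
def colMoveFun (n : ℕ) (j : Fin n) : RPos n → RPos n :=
  fun p => if p.1 = j then (p.1, p.2.1.rev, !p.2.2) else p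

theorem colMoveFun_involutive (n : ℕ) (j : Fin n) :
    Function.Involutive (colMoveFun n j) := by
  rintro ⟨x, y, b⟩
  by_cases h : x = j <;> simp [colMoveFun, h]

/-- The column move `σ j`. -/
def colMove (n : ℕ) (j : Fin n) : Equiv.Perm (RPos n) :=
  (colMoveFun_involutive n j).toPerm _

/-- The set `S(n)` of the `2n` legal moves. -/
def RMoves (n : ℕ) : Set (Equiv.Perm (RPos n)) :=
  Set.range (rowMove n) ∪ Set.range (colMove n)

/-- The group `G(n)` generated by the legal moves. -/
def RGroup (n : ℕ) : Subgroup (Equiv.Perm (RPos n)) :=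
  Subgroup.closure (RMoves n)

/-- The solved coloring `c₀`. -/
def solvedColoring (n : ℕ) : RPos n → Bool := fun p => p.2.2

/-- The cluster `Cl(x, y)`. -/
def cluster (n : ℕ) (x y : Fin n) : Set (RPos n) :=
  {p | (p.1 = x ∨ p.1 = x.rev) ∧ (p.2.1 = y ∨ p.2.1 = y.rev)}

/-- The configuration of cluster `(x, y)` under a coloring `c`. -/
def clusterConfig (n : ℕ) (c : RPos n → Bool) (x y : Fin n) :
    Bool × Bool → Bool :=
  fun q => c (if q.1 then x.rev else x, if q.2 then y.rev else y, true)

/-- An interior index pair: `1 ≤ x ≤ ⌊n/2⌋ − 1` and `1 ≤ y ≤ ⌊n/2⌋ − 1`. -/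
def Interior (n : ℕ) (x y : Fin n) : Prop :=
  1 ≤ (x : ℕ) ∧ (x : ℕ) ≤ n / 2 - 1 ∧ 1 ≤ (y : ℕ) ∧ (y : ℕ) ≤ n / 2 - 1

/-- The six standard patterns: functions `Bool × Bool → Bool` whose value is
independent of the second argument or independent of the first argument. -/
def StandardPattern (f : Bool × Bool → Bool) : Prop :=
  (∀ ε δ δ', f (ε, δ) = f (ε, δ')) ∨ (∀ ε ε' δ, f (ε, δ) = f (ε', δ))

/-- A decomposition of a finite set of pairs into disjoint combinatorial rectangles whose
total semiperimeter is at most the given number. -/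
inductive RectDecomp {α β : Type*} [DecidableEq α] [DecidableEq β] :
    ℕ → Finset (α × β) → Prop
  | rect (X : Finset α) (Y : Finset β) : RectDecomp (X.card + Y.card) (X ×ˢ Y)
  | union {k l : ℕ} {Z W : Finset (α × β)} (hd : Disjoint Z W) (hZ : RectDecomp k Z)
      (hW : RectDecomp l W) : RectDecomp (k + l) (Z ∪ W)
  | mono {k l : ℕ} {Z : Finset (α × β)} (h : k ≤ l) (hZ : RectDecomp k Z) : RectDecomp l Z

namespace RectDecomp

variable {α β : Type*} [DecidableEq α] [DecidableEq β]

theorem empty : RectDecomp 0 (∅ : Finset (α × β)) := by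
  simpa using rect (∅ : Finset α) (∅ : Finset β)

theorem biUnion {ι : Type*} [DecidableEq ι] (s : Finset ι) (k : ι → ℕ) (f : ι → Finset (α × β))
    (hd : ∀ i j, i ≠ j → Disjoint (f i) (f j)) (h : ∀ i ∈ s, RectDecomp (k i) (f i)) :
    RectDecomp (∑ i ∈ s, k i) (s.biUnion f) := by
  induction s using Finset.induction_on with
  | empty => simpa using empty
  | insert a s ha ih =>
    rw [Finset.sum_insert ha, Finset.biUnion_insert]
    refine union ?_ (h a (Finset.mem_insert_self a s))
      (ih fun i hi => h i (Finset.mem_insert_of_mem hi))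
    rw [Finset.disjoint_biUnion_right]
    exact fun i hi => hd a i fun e => ha (e ▸ hi)

/-- A set of pairs supported on few columns decomposes by grouping equal rows. -/
theorem of_subset_product (B : Finset α) (Y : Finset β) (Z : Finset (α × β))
    (hZ : Z ⊆ B ×ˢ Y) : RectDecomp (B.card * 2 ^ B.card + Y.card) Z := by
  set row : β → Finset α := fun y => B.filter fun x => (x, y) ∈ Z with hrow
  have key := biUnion B.powerset (fun S => S.card + (Y.filter fun y => row y = S).card)
    (fun S => S ×ˢ Y.filter fun y => row y = S) (fun S T hST => by
      rw [Finset.disjoint_left]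
      rintro ⟨x, y⟩ h1 h2
      simp only [Finset.mem_product, Finset.mem_filter] at h1 h2
      exact hST (h1.2.2.symm.trans h2.2.2)) fun S _ => rect _ _
  have hunion : (B.powerset.biUnion fun S => S ×ˢ Y.filter fun y => row y = S) = Z := by
    ext ⟨x, y⟩
    simp only [Finset.mem_biUnion, Finset.mem_powerset, Finset.mem_product, Finset.mem_filter]
    constructor
    · rintro ⟨S, -, hx, -, rfl⟩
      exact (Finset.mem_filter.1 hx).2
    · intro h
      have h' := Finset.mem_product.1 (hZ h)
      exact ⟨row y, Finset.filter_subset _ _, Finset.mem_filter.2 ⟨h'.1, h⟩, h'.2, rfl⟩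
  rw [hunion] at key
  refine key.mono ?_
  rw [Finset.sum_add_distrib]
  gcongr
  · calc ∑ S ∈ B.powerset, S.card ≤ ∑ S ∈ B.powerset, B.card :=
          Finset.sum_le_sum fun S hS => Finset.card_le_card (Finset.mem_powerset.1 hS)
      _ = B.card * 2 ^ B.card := by
          rw [Finset.sum_const, Finset.card_powerset, smul_eq_mul, mul_comm]
  · exact (Finset.card_eq_sum_card_fiberwise fun y _ =>
      Finset.mem_powerset.2 (Finset.filter_subset _ _)).ge

/-- Split a set of pairs into blocks of `c` columns and decompose each block separately. -/
theorem of_block_size {n : ℕ} (Z : Finset (Fin n × Fin n)) {c : ℕ} (hc : 0 < c) :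
    RectDecomp ((n / c + 1) * (c * 2 ^ c + n)) Z := by
  have hblock : ∀ b : ℕ, (Finset.univ.filter fun x : Fin n => x.val / c = b).card ≤ c := by
    intro b
    calc _ ≤ (Finset.Ico (b * c) (b * c + c)).card := by
          refine Finset.card_le_card_of_injOn Fin.val ?_ Fin.val_injective.injOn
          intro x hx
          have hx' : x.val / c = b := by simpa using hx
          have h1 := Nat.div_add_mod x.val c
          have h2 := Nat.mod_lt x.val hc
          rw [hx', mul_comm] at h1
          simp only [Finset.coe_Ico, Set.mem_Ico]
          omega
      _ = c := by simp
  have key := biUnion (Finset.range (n / c + 1)) (fun _ => c * 2 ^ c + n)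
    (fun b => Z.filter fun p => p.1.val / c = b) (fun i j hij => by
      rw [Finset.disjoint_left]
      intro p h1 h2
      exact hij ((Finset.mem_filter.1 h1).2.symm.trans (Finset.mem_filter.1 h2).2)) fun b _ => by
      refine (of_subset_product (Finset.univ.filter fun x : Fin n => x.val / c = b)
        Finset.univ _ fun p hp => ?_).mono ?_
      · simpa using (Finset.mem_filter.1 hp).2
      · rw [Finset.card_univ, Fintype.card_fin]
        have := hblock b
        gcongr
        norm_num
  have hunion : ((Finset.range (n / c + 1)).biUnion fun b => Z.filter fun p => p.1.val / c = b)
      = Z := by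
    ext p
    simp only [Finset.mem_biUnion, Finset.mem_range, Finset.mem_filter]
    constructor
    · rintro ⟨b, -, h, -⟩
      exact h
    · exact fun h => ⟨_, Nat.lt_succ_of_le (Nat.div_le_div_right p.1.isLt.le), h, rfl⟩
  rw [hunion] at key
  simpa using key

end RectDecomp

/-- The block size `⌊log₂ n⌋ / 2 + 1` balances the two terms of `RectDecomp.of_block_size`. -/
theorem exists_block_size {n : ℕ} (hn : 2 ≤ n) : ∃ c : ℕ, 0 < c ∧
    (((n / c + 1) * (c * 2 ^ c + n) : ℕ) : ℝ) ≤ 12 * (n : ℝ) ^ 2 / Real.log n := by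
  obtain ⟨h, hh⟩ : ∃ h, h = Nat.log 2 n / 2 := ⟨_, rfl⟩
  have hpow : 2 ^ (2 * h) ≤ n :=
    (Nat.pow_le_pow_right two_pos (by omega)).trans (Nat.pow_log_le_self 2 (by omega))
  have hlin : h + 1 ≤ 2 ^ h := Nat.lt_two_pow_self
  have hone : 1 ≤ 2 ^ h := Nat.one_le_two_pow
  have hsq : 2 ^ h * 2 ^ h ≤ n := by rwa [← pow_add, ← two_mul]
  have hcn : h + 1 ≤ n := by nlinarith
  have hsum : (h + 1) * 2 ^ (h + 1) + n ≤ 3 * n := by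
    rw [pow_succ]
    nlinarith
  have hn0 : (0 : ℝ) < n := by positivity
  have hlogpos : 0 < Real.log n := Real.log_pos (by exact_mod_cast hn)
  have hlog : Real.log n ≤ 2 * ((h : ℝ) + 1) := by
    have hlt : n < 2 ^ (2 * (h + 1)) :=
      (Nat.lt_pow_succ_log_self one_lt_two n).trans_le (Nat.pow_le_pow_right two_pos (by omega))
    have hle : Real.log n ≤ Real.log ((2 : ℝ) ^ (2 * (h + 1))) :=
      Real.log_le_log hn0 (by exact_mod_cast hlt.le)
    rw [Real.log_pow] at hle
    push_cast at hle
    have h2 : Real.log 2 ≤ 1 := by linarith [Real.log_two_lt_d9]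
    have : (0 : ℝ) ≤ 2 * ((h : ℝ) + 1) := by positivity
    nlinarith
  refine ⟨h + 1, h.succ_pos, ?_⟩
  have hc0 : (0 : ℝ) < (h : ℝ) + 1 := by positivity
  have hdiv : ((n / (h + 1) : ℕ) : ℝ) + 1 ≤ 2 * n / ((h : ℝ) + 1) := by
    have h1 : ((n / (h + 1) : ℕ) : ℝ) ≤ n / ((h : ℝ) + 1) := by
      simpa using Nat.cast_div_le (α := ℝ) (m := n) (n := h + 1)
    have h2 : (1 : ℝ) ≤ n / ((h : ℝ) + 1) := by
      rw [one_le_div hc0]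
      exact_mod_cast hcn
    linarith [mul_div_assoc (2 : ℝ) n ((h : ℝ) + 1)]
  calc (((n / (h + 1) + 1) * ((h + 1) * 2 ^ (h + 1) + n) : ℕ) : ℝ)
      ≤ (((n / (h + 1) + 1) * (3 * n) : ℕ) : ℝ) := by exact_mod_cast Nat.mul_le_mul_left _ hsum
    _ = (((n / (h + 1) : ℕ) : ℝ) + 1) * (3 * n) := by push_cast; ring
    _ ≤ 2 * n / ((h : ℝ) + 1) * (3 * n) := by gcongr
    _ = 12 * (n : ℝ) ^ 2 / (2 * ((h : ℝ) + 1)) := by field_simp; ring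
    _ ≤ 12 * (n : ℝ) ^ 2 / Real.log n := by gcongr

/-- The colours of the front stickers of an `n × n × 1` cube. -/
abbrev FaceGrid (n : ℕ) := Fin n → Fin n → Bool

namespace FaceGrid

variable {n : ℕ}

/-- Perform the row moves with index in `R`. -/
def flipRows (R : Finset (Fin n)) (A : FaceGrid n) : FaceGrid n :=
  fun x y => if y ∈ R then !A x.rev y else A x y

/-- Perform the column moves with index in `K`. -/
def flipCols (K : Finset (Fin n)) (A : FaceGrid n) : FaceGrid n :=
  fun x y => if x ∈ K then !A x y.rev else A x y

/-- `Reaches k A B`: at most `k` moves lead from `A` to `B`. -/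
inductive Reaches : ℕ → FaceGrid n → FaceGrid n → Prop
  | refl (k : ℕ) (A : FaceGrid n) : Reaches k A A
  | row {k : ℕ} {A B : FaceGrid n} (i : Fin n) (h : Reaches k A B) :
      Reaches (k + 1) A (flipRows {i} B)
  | col {k : ℕ} {A B : FaceGrid n} (j : Fin n) (h : Reaches k A B) :
      Reaches (k + 1) A (flipCols {j} B)

theorem Reaches.trans {k l : ℕ} {A B D : FaceGrid n} (h₁ : Reaches k A B) (h₂ : Reaches l B D) :
    Reaches (k + l) A D := by
  induction h₂ with
  | refl l B =>
    induction h₁ with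
    | refl k A => exact .refl _ _
    | @row k _ _ i _ ih => rw [Nat.add_right_comm]; exact ih.row i
    | @col k _ _ j _ ih => rw [Nat.add_right_comm]; exact ih.col j
  | row i _ ih => exact (ih h₁).row i
  | col j _ ih => exact (ih h₁).col j

theorem Reaches.mono {k l : ℕ} {A B : FaceGrid n} (h : Reaches k A B) (hkl : k ≤ l) :
    Reaches l A B := by
  obtain ⟨m, rfl⟩ := Nat.exists_eq_add_of_le hkl
  exact h.trans (.refl m B)

theorem reaches_flipRows (R : Finset (Fin n)) (A : FaceGrid n) :
    Reaches R.card A (flipRows R A) := by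
  induction R using Finset.induction_on with
  | empty => exact .refl 0 A
  | insert i R hi ih =>
    have : flipRows (insert i R) A = flipRows {i} (flipRows R A) := by
      funext x y
      by_cases h : y = i
      · subst h; simp [flipRows, hi]
      · simp [flipRows, h]
    rw [Finset.card_insert_of_notMem hi, this]
    exact ih.row i

theorem reaches_flipCols (K : Finset (Fin n)) (A : FaceGrid n) :
    Reaches K.card A (flipCols K A) := by
  induction K using Finset.induction_on with
  | empty => exact .refl 0 A
  | insert j K hj ih =>
    have : flipCols (insert j K) A = flipCols {j} (flipCols K A) := by
      funext x y
      by_cases h : x = j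
      · subst h; simp [flipCols, hj]
      · simp [flipCols, h]
    rw [Finset.card_insert_of_notMem hj, this]
    exact ih.col j

/-- The colours of the cluster of `(x, y)`. -/
def pattern (A : FaceGrid n) (x y : Fin n) : Bool × Bool × Bool × Bool :=
  (A x y, A x.rev y, A x y.rev, A x.rev y.rev)

/-- The patterns that are constant on rows or constant on columns. -/
def standardPatterns : List (Bool × Bool × Bool × Bool) :=
  [(true, true, true, true), (false, false, false, false),
   (true, true, false, false), (false, false, true, true),
   (true, false, true, false), (false, true, false, true)]

/-- Every cluster shows a standard pattern. -/
def IsStandard (A : FaceGrid n) : Prop :=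
  ∀ x y, A.pattern x y ∈ standardPatterns

theorem IsStandard.flipRows_singleton {A : FaceGrid n} (hA : A.IsStandard) (i : Fin n) :
    (flipRows {i} A).IsStandard := by
  intro x y
  have h := hA x y
  simp only [pattern, flipRows, Finset.mem_singleton, Fin.rev_rev] at h ⊢
  clear hA
  generalize A x y = a, A x.rev y = b, A x y.rev = c, A x.rev y.rev = d at h ⊢
  split_ifs <;> revert a b c d <;> decide

theorem IsStandard.flipCols_singleton {A : FaceGrid n} (hA : A.IsStandard) (j : Fin n) :
    (flipCols {j} A).IsStandard := by
  intro x y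
  have h := hA x y
  simp only [pattern, flipCols, Finset.mem_singleton, Fin.rev_rev] at h ⊢
  clear hA
  generalize A x y = a, A x.rev y = b, A x y.rev = c, A x.rev y.rev = d at h ⊢
  split_ifs <;> revert a b c d <;> decide

theorem IsStandard.of_reaches {k : ℕ} {A B : FaceGrid n} (h : Reaches k A B)
    (hA : A.IsStandard) : B.IsStandard := by
  induction h with
  | refl => exact hA
  | row i _ ih => exact (ih hA).flipRows_singleton i
  | col j _ ih => exact (ih hA).flipCols_singleton j

/-- Replace the clusters of the pairs in `Z` by solved ones. -/
def solveOn (Z : Finset (Fin n × Fin n)) (A : FaceGrid n) : FaceGrid n := fun x y =>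
  if (x, y) ∈ Z ∨ (x.rev, y) ∈ Z ∨ (x, y.rev) ∈ Z ∨ (x.rev, y.rev) ∈ Z then true else A x y

/-- The pairs in the open lower left quarter, one for each cluster off the central cross. -/
def quarter (n : ℕ) : Finset (Fin n × Fin n) :=
  Finset.univ.filter fun p => p.1 < p.1.rev ∧ p.2 < p.2.rev

theorem mem_quarter {x y : Fin n} : (x, y) ∈ quarter n ↔ x < x.rev ∧ y < y.rev := by
  simp [quarter]

theorem pattern_solveOn {Z : Finset (Fin n × Fin n)} (hZ : Z ⊆ quarter n) (A : FaceGrid n)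
    {x y : Fin n} (hxy : (x, y) ∈ quarter n) :
    (solveOn Z A).pattern x y =
      if (x, y) ∈ Z then (true, true, true, true) else A.pattern x y := by
  rw [mem_quarter] at hxy
  have h1 : (x.rev, y) ∉ Z := fun h => by
    have := (mem_quarter.1 (hZ h)).1
    rw [Fin.rev_rev] at this
    exact lt_asymm this hxy.1
  have h2 : ∀ u, (u, y.rev) ∉ Z := fun u h => by
    have := (mem_quarter.1 (hZ h)).2
    rw [Fin.rev_rev] at this
    exact lt_asymm this hxy.2
  by_cases h : (x, y) ∈ Z <;> simp [pattern, solveOn, h, h1, h2]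

theorem solveOn_of_eq_rev {Z : Finset (Fin n × Fin n)} (hZ : Z ⊆ quarter n) (A : FaceGrid n)
    {x y : Fin n} (hxy : x = x.rev ∨ y = y.rev) : solveOn Z A x y = A x y := by
  refine if_neg fun h => ?_
  rcases h with h | h | h | h <;> have h' := mem_quarter.1 (hZ h) <;>
    rw [← Fin.val_inj, ← Fin.val_inj] at hxy <;>
    simp only [Fin.lt_def, Fin.val_rev] at h' hxy <;> omega

theorem solveOn_union (Z W : Finset (Fin n × Fin n)) (A : FaceGrid n) :
    solveOn (Z ∪ W) A = solveOn W (solveOn Z A) := by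
  funext x y
  simp only [solveOn, Finset.mem_union]
  split_ifs <;> first | rfl | (exfalso; tauto)

theorem card_union_image_rev_le (Y : Finset (Fin n)) (p q : Prop) [Decidable p] [Decidable q] :
    ((if p then Y else ∅) ∪ (if q then Y.image Fin.rev else ∅)).card ≤ 2 * Y.card := by
  have h1 : (if p then Y else ∅).card ≤ Y.card := by split_ifs <;> simp
  have h2 : (if q then Y.image Fin.rev else ∅).card ≤ Y.card := by
    split_ifs
    · exact Finset.card_image_le
    · simp
  linarith [Finset.card_union_le (if p then Y else ∅) (if q then Y.image Fin.rev else ∅)]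

theorem mem_image_rev {Y : Finset (Fin n)} {y : Fin n} : y ∈ Y.image Fin.rev ↔ y.rev ∈ Y := by
  rw [Finset.mem_image]
  exact ⟨by rintro ⟨z, hz, rfl⟩; rwa [Fin.rev_rev], fun h => ⟨_, h, Fin.rev_rev y⟩⟩

/-- A commutator of row and column moves solves a rectangle of clusters that are constant on rows
with the same pattern. -/
theorem flip_commutator_rows (X Y : Finset (Fin n)) (hX : ∀ x ∈ X, x < x.rev)
    (hY : ∀ y ∈ Y, y < y.rev) (a b : Bool) (A : FaceGrid n)
    (hA : ∀ x ∈ X, ∀ y ∈ Y, A.pattern x y = (a, a, b, b)) :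
    let R := (if a = false then Y else ∅) ∪ (if b = false then Y.image Fin.rev else ∅)
    flipCols X (flipRows R (flipCols X (flipRows R A))) = solveOn (X ×ˢ Y) A := by
  intro R
  have hX' : ∀ x ∈ X, x.rev ∉ X := fun x hx h => by
    have := hX _ h
    rw [Fin.rev_rev] at this
    exact lt_asymm this (hX x hx)
  have hY' : ∀ y ∈ Y, y.rev ∉ Y := fun y hy h => by
    have := hY _ h
    rw [Fin.rev_rev] at this
    exact lt_asymm this (hY y hy)
  have hR : ∀ y, y ∈ R ↔ (a = false ∧ y ∈ Y) ∨ (b = false ∧ y.rev ∈ Y) := by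
    intro y
    rw [Finset.mem_union, ← mem_image_rev]
    split_ifs with h1 h2 h2 <;> simp [h1, h2]
  have hpat : ∀ x ∈ X, ∀ y ∈ Y, A x y = a ∧ A x.rev y = a ∧ A x y.rev = b ∧ A x.rev y.rev = b := by
    intro x hx y hy
    simpa [pattern] using hA x hx y hy
  clear_value R
  funext x y
  have hx := hX' x
  have hy := hY' y
  have h₁ := hpat x
  have h₂ := hpat x.rev
  have h₃ := fun hx => h₁ hx y.rev
  have h₄ := fun hx => h₂ hx y.rev
  replace h₁ := fun hx => h₁ hx y
  replace h₂ := fun hx => h₂ hx y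
  simp only [flipCols, flipRows, solveOn, Finset.mem_product, hR, Fin.rev_rev] at h₂ h₃ h₄ ⊢
  clear hX hY hA hX' hY' hR hpat
  generalize A x y = p, A x.rev y = q, A x y.rev = r, A x.rev y.rev = s at h₁ h₂ h₃ h₄ ⊢
  by_cases x ∈ X <;> by_cases x.rev ∈ X <;> by_cases y ∈ Y <;> by_cases y.rev ∈ Y <;>
    simp_all

/-- The analogue of `flip_commutator_rows` for clusters that are constant on columns. -/
theorem flip_commutator_cols (X Y : Finset (Fin n)) (hX : ∀ x ∈ X, x < x.rev)
    (hY : ∀ y ∈ Y, y < y.rev) (a b : Bool) (A : FaceGrid n)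
    (hA : ∀ x ∈ X, ∀ y ∈ Y, A.pattern x y = (a, b, a, b)) :
    let K := (if a = false then X else ∅) ∪ (if b = false then X.image Fin.rev else ∅)
    flipRows Y (flipCols K (flipRows Y (flipCols K A))) = solveOn (X ×ˢ Y) A := by
  have h := flip_commutator_rows Y X hY hX a b (fun x y => A y x) fun y hy x hx => by
    have := hA x hx y hy
    simp only [pattern, Prod.mk.injEq] at this ⊢
    tauto
  intro K
  funext x y
  refine (congrFun (congrFun h y) x).trans ?_
  simp only [solveOn, Finset.mem_product]
  congr 1
  simp only [eq_iff_iff]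
  tauto

theorem reaches_solveOn_rect (X Y : Finset (Fin n)) (hXY : X ×ˢ Y ⊆ quarter n)
    {q : Bool × Bool × Bool × Bool} (hq : q ∈ standardPatterns) (A : FaceGrid n)
    (hA : ∀ p ∈ X ×ˢ Y, A.pattern p.1 p.2 = q) :
    Reaches (4 * (X.card + Y.card)) A (solveOn (X ×ˢ Y) A) := by
  rcases (X ×ˢ Y).eq_empty_or_nonempty with he | ⟨⟨x₀, y₀⟩, h₀⟩
  · have : solveOn (X ×ˢ Y) A = A := by
      funext x y
      simp [solveOn, he]
    rw [this]
    exact .refl _ _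
  obtain ⟨hx₀, hy₀⟩ := Finset.mem_product.1 h₀
  have hX : ∀ x ∈ X, x < x.rev := fun x hx =>
    (mem_quarter.1 (hXY (Finset.mk_mem_product hx hy₀))).1
  have hY : ∀ y ∈ Y, y < y.rev := fun y hy =>
    (mem_quarter.1 (hXY (Finset.mk_mem_product hx₀ hy))).2
  replace hA : ∀ x ∈ X, ∀ y ∈ Y, A.pattern x y = q := fun x hx y hy =>
    hA (x, y) (Finset.mk_mem_product hx hy)
  have hform : (∃ a b, q = (a, a, b, b)) ∨ ∃ a b, q = (a, b, a, b) := by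
    clear hA
    revert q
    decide
  rcases hform with ⟨a, b, rfl⟩ | ⟨a, b, rfl⟩
  · rw [← flip_commutator_rows X Y hX hY a b A hA]
    have hc := card_union_image_rev_le Y (a = false) (b = false)
    exact ((((reaches_flipRows _ A).trans (reaches_flipCols X _)).trans
      (reaches_flipRows _ _)).trans (reaches_flipCols X _)).mono (by omega)
  · rw [← flip_commutator_cols X Y hX hY a b A hA]
    have hc := card_union_image_rev_le X (a = false) (b = false)
    exact ((((reaches_flipCols _ A).trans (reaches_flipRows Y _)).trans
      (reaches_flipCols _ _)).trans (reaches_flipRows Y _)).mono (by omega)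

/-- Clusters showing a common standard pattern are solved at the cost of a rectangle
decomposition. -/
theorem reaches_solveOn {k : ℕ} {Z : Finset (Fin n × Fin n)} (hZ : RectDecomp k Z)
    (hsub : Z ⊆ quarter n) {q : Bool × Bool × Bool × Bool} (hq : q ∈ standardPatterns)
    (A : FaceGrid n) (hA : ∀ p ∈ Z, A.pattern p.1 p.2 = q) :
    Reaches (4 * k) A (solveOn Z A) := by
  induction hZ generalizing A with
  | rect X Y => exact reaches_solveOn_rect X Y hsub hq A hA
  | union hd _ _ ihZ ihW =>
    have hsubZ := Finset.union_subset_left hsub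
    have hsubW := Finset.union_subset_right hsub
    rw [solveOn_union, mul_add]
    refine (ihZ hsubZ A fun p hp => hA p (Finset.mem_union_left _ hp)).trans
      (ihW hsubW _ fun p hp => ?_)
    rw [pattern_solveOn hsubZ A (hsubW hp), if_neg (Finset.disjoint_right.1 hd hp)]
    exact hA p (Finset.mem_union_right _ hp)
  | mono h _ ih => exact (ih hsub A hA).mono (by omega)

theorem exists_reaches_solve_patterns {K : ℕ}
    (hK : ∀ Z : Finset (Fin n × Fin n), RectDecomp K Z)
    (l : List (Bool × Bool × Bool × Bool)) (hl : ∀ q ∈ l, q ∈ standardPatterns)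
    (A : FaceGrid n) :
    ∃ B : FaceGrid n, Reaches (l.length * (4 * K)) A B ∧
      (∀ x y, x = x.rev ∨ y = y.rev → B x y = A x y) ∧
      ∀ x y, (x, y) ∈ quarter n → B.pattern x y = (true, true, true, true) ∨
        (B.pattern x y = A.pattern x y ∧ A.pattern x y ∉ l) := by
  induction l generalizing A with
  | nil => exact ⟨A, .refl _ _, fun _ _ _ => rfl, fun _ _ _ => .inr ⟨rfl, List.not_mem_nil⟩⟩
  | cons q l ih =>
    set Z := (quarter n).filter fun p => A.pattern p.1 p.2 = q with hZdef
    have hZ : Z ⊆ quarter n := Finset.filter_subset _ _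
    have hstep := reaches_solveOn (hK Z) hZ (hl q List.mem_cons_self) A
      fun p hp => (Finset.mem_filter.1 hp).2
    obtain ⟨B, hB, hcross, hpat⟩ := ih (fun p hp => hl p (List.mem_cons_of_mem q hp)) (solveOn Z A)
    refine ⟨B, (hstep.trans hB).mono (by rw [List.length_cons]; linarith),
      fun x y h => (hcross x y h).trans (solveOn_of_eq_rev hZ A h), fun x y hxy => ?_⟩
    have h := hpat x y hxy
    rw [pattern_solveOn hZ A hxy] at h
    by_cases hmem : (x, y) ∈ Z
    · rw [if_pos hmem] at h
      exact .inl (h.elim id And.left)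
    · rw [if_neg hmem] at h
      refine h.imp_right fun h => ⟨h.1, fun hin => ?_⟩
      rcases List.mem_cons.1 hin with e | e
      · exact hmem (Finset.mem_filter.2 ⟨hxy, e⟩)
      · exact h.2 e

/-- The central row and column can be solved in linearly many moves. -/
theorem exists_reaches_solve_cross (A : FaceGrid n) : ∃ B : FaceGrid n, Reaches (2 * n) A B ∧
    ∀ x y, x = x.rev ∨ y = y.rev → B x y = true := by
  have huniq : ∀ x z : Fin n, x = x.rev → z = z.rev → x = z := by
    intro x z hx hz
    rw [← Fin.val_inj, Fin.val_rev] at hx hz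
    exact Fin.ext (by omega)
  set R : Finset (Fin n) := Finset.univ.filter fun y => ∃ x : Fin n, x = x.rev ∧ A x y = false
    with hR
  set D := flipRows R A with hD
  set K : Finset (Fin n) := Finset.univ.filter fun x =>
    x ≠ x.rev ∧ ∃ y : Fin n, y = y.rev ∧ D x y = false with hK
  have hDcol : ∀ x y, x = x.rev → D x y = true := by
    intro x y hx
    by_cases hy : y ∈ R
    · obtain ⟨z, hz, hzA⟩ := (Finset.mem_filter.1 hy).2
      rw [huniq z x hz hx] at hzA
      simp [hD, flipRows, hy, ← hx, hzA]
    · have : A x y ≠ false := fun h => hy (Finset.mem_filter.2 ⟨Finset.mem_univ y, x, hx, h⟩)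
      simpa [hD, flipRows, hy] using this
  refine ⟨flipCols K D, ((reaches_flipRows R A).trans (reaches_flipCols K D)).mono ?_, ?_⟩
  · have h1 := R.card_le_univ
    have h2 := K.card_le_univ
    rw [Fintype.card_fin] at h1 h2
    omega
  · intro x y hxy
    by_cases hx : x = x.rev
    · have : x ∉ K := fun h => (Finset.mem_filter.1 h).2.1 hx
      simp [flipCols, this, hDcol x y hx]
    · have hy := hxy.resolve_left hx
      by_cases hxK : x ∈ K
      · obtain ⟨-, z, hz, hzD⟩ := (Finset.mem_filter.1 hxK).2
        rw [huniq z y hz hy] at hzD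
        simp [flipCols, hxK, ← hy, hzD]
      · have : D x y ≠ false := fun h => hxK (Finset.mem_filter.2 ⟨Finset.mem_univ x, hx, y, hy, h⟩)
        simpa [flipCols, hxK] using this

theorem IsStandard.reaches_solved {K : ℕ} (hK : ∀ Z : Finset (Fin n × Fin n), RectDecomp K Z)
    {A : FaceGrid n} (hA : A.IsStandard) : Reaches (2 * n + 24 * K) A fun _ _ => true := by
  obtain ⟨D, hD, hDcross⟩ := exists_reaches_solve_cross A
  obtain ⟨B, hB, hBcross, hBpat⟩ :=
    exists_reaches_solve_patterns hK standardPatterns (fun _ => id) D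
  have hstd := hA.of_reaches hD
  have hquarter : ∀ x y, x < x.rev → y < y.rev →
      B x y = true ∧ B x.rev y = true ∧ B x y.rev = true ∧ B x.rev y.rev = true := by
    intro x y hx hy
    have h := (hBpat x y (mem_quarter.2 ⟨hx, hy⟩)).resolve_right fun h => h.2 (hstd x y)
    simpa [pattern] using h
  have hsolved : B = fun _ _ => true := by
    funext x y
    rcases lt_trichotomy x x.rev with hx | hx | hx
    · rcases lt_trichotomy y y.rev with hy | hy | hy
      · exact (hquarter x y hx hy).1
      · rw [hBcross x y (.inr hy), hDcross x y (.inr hy)]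
      · simpa using (hquarter x y.rev hx (by simpa using hy)).2.2.1
    · rw [hBcross x y (.inl hx), hDcross x y (.inl hx)]
    · rcases lt_trichotomy y y.rev with hy | hy | hy
      · simpa using (hquarter x.rev y (by simpa using hx) hy).2.1
      · rw [hBcross x y (.inr hy), hDcross x y (.inr hy)]
      · simpa using (hquarter x.rev y.rev (by simpa using hx) (by simpa using hy)).2.2.2
  rw [← hsolved]
  refine (hD.trans hB).mono ?_
  simp only [standardPatterns, List.length_cons, List.length_nil]
  omega

/-- The front colours of the coloring produced by `g`. -/
def ofPerm (g : Equiv.Perm (RPos n)) : FaceGrid n :=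
  fun x y => solvedColoring n (g⁻¹ (x, y, true))

/-- Opposite sides of a piece have opposite colours in the coloring produced by `g`. -/
def TwoSided (g : Equiv.Perm (RPos n)) : Prop :=
  ∀ x y, solvedColoring n (g⁻¹ (x, y, false)) = !ofPerm g x y

theorem rowMove_inv (i : Fin n) : (rowMove n i)⁻¹ = rowMove n i := rfl

theorem colMove_inv (j : Fin n) : (colMove n j)⁻¹ = colMove n j := rfl

theorem rowMove_apply (i x y : Fin n) (b : Bool) :
    rowMove n i (x, y, b) = if y = i then (x.rev, y, !b) else (x, y, b) := rfl

theorem colMove_apply (j x y : Fin n) (b : Bool) :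
    colMove n j (x, y, b) = if x = j then (x, y.rev, !b) else (x, y, b) := rfl

theorem TwoSided.ofPerm_rowMove_mul {g : Equiv.Perm (RPos n)} (hg : TwoSided g) (i : Fin n) :
    ofPerm (rowMove n i * g) = flipRows {i} (ofPerm g) := by
  funext x y
  have h := hg x.rev y
  simp only [ofPerm, flipRows, mul_inv_rev, Equiv.Perm.mul_apply, rowMove_inv, rowMove_apply,
    Finset.mem_singleton] at h ⊢
  split_ifs <;> simp only [Bool.not_true, h]

theorem TwoSided.ofPerm_colMove_mul {g : Equiv.Perm (RPos n)} (hg : TwoSided g) (j : Fin n) :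
    ofPerm (colMove n j * g) = flipCols {j} (ofPerm g) := by
  funext x y
  have h := hg x y.rev
  simp only [ofPerm, flipCols, mul_inv_rev, Equiv.Perm.mul_apply, colMove_inv, colMove_apply,
    Finset.mem_singleton] at h ⊢
  split_ifs <;> simp only [Bool.not_true, h]

theorem TwoSided.rowMove_mul {g : Equiv.Perm (RPos n)} (hg : TwoSided g) (i : Fin n) :
    TwoSided (rowMove n i * g) := by
  intro x y
  have h := hg x.rev y
  have h' := hg x y
  simp only [ofPerm, mul_inv_rev, Equiv.Perm.mul_apply, rowMove_inv, rowMove_apply] at h h' ⊢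
  split_ifs <;> simp only [Bool.not_true, Bool.not_false, Bool.not_not, h, h']

theorem TwoSided.colMove_mul {g : Equiv.Perm (RPos n)} (hg : TwoSided g) (j : Fin n) :
    TwoSided (colMove n j * g) := by
  intro x y
  have h := hg x y.rev
  have h' := hg x y
  simp only [ofPerm, mul_inv_rev, Equiv.Perm.mul_apply, colMove_inv, colMove_apply] at h h' ⊢
  split_ifs <;> simp only [Bool.not_true, Bool.not_false, Bool.not_not, h, h']

theorem twoSided_and_isStandard_of_mem {g : Equiv.Perm (RPos n)} (hg : g ∈ RGroup n) :
    TwoSided g ∧ (ofPerm g).IsStandard := by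
  have hmul : ∀ m ∈ RMoves n, ∀ h : Equiv.Perm (RPos n), TwoSided h ∧ (ofPerm h).IsStandard →
      TwoSided (m * h) ∧ (ofPerm (m * h)).IsStandard := by
    rintro m (⟨i, rfl⟩ | ⟨j, rfl⟩) h ⟨h1, h2⟩
    · exact ⟨h1.rowMove_mul i, h1.ofPerm_rowMove_mul i ▸ h2.flipRows_singleton i⟩
    · exact ⟨h1.colMove_mul j, h1.ofPerm_colMove_mul j ▸ h2.flipCols_singleton j⟩
  have hinv : ∀ m ∈ RMoves n, m⁻¹ = m := by
    rintro m (⟨i, rfl⟩ | ⟨j, rfl⟩)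
    exacts [rowMove_inv i, colMove_inv j]
  induction hg using Subgroup.closure_induction_left with
  | one =>
    refine ⟨fun x y => rfl, fun x y => ?_⟩
    exact List.mem_cons_self
  | mul_left m hm h _ ih => exact hmul m hm h ih
  | inv_mul_cancel m hm h _ ih => rw [hinv m hm]; exact hmul m hm h ih

theorem Reaches.exists_moves {k : ℕ} {A B : FaceGrid n} (h : Reaches k A B)
    {g : Equiv.Perm (RPos n)} (hg : TwoSided g) (hA : ofPerm g = A) :
    ∃ L : List (Equiv.Perm (RPos n)), (∀ m ∈ L, m ∈ RMoves n) ∧ L.length ≤ k ∧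
      TwoSided (L.prod * g) ∧ ofPerm (L.prod * g) = B := by
  induction h with
  | refl k A => exact ⟨[], by simp, by simp, by simpa using hg, by simpa using hA⟩
  | row i _ ih =>
    obtain ⟨L, hL, hlen, h1, h2⟩ := ih hA
    refine ⟨rowMove n i :: L, ?_, by simpa using hlen, ?_, ?_⟩
    · exact List.forall_mem_cons.2 ⟨.inl ⟨i, rfl⟩, hL⟩
    · rw [List.prod_cons, mul_assoc]
      exact h1.rowMove_mul i
    · rw [List.prod_cons, mul_assoc, h1.ofPerm_rowMove_mul i, h2]
  | col j _ ih =>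
    obtain ⟨L, hL, hlen, h1, h2⟩ := ih hA
    refine ⟨colMove n j :: L, ?_, by simpa using hlen, ?_, ?_⟩
    · exact List.forall_mem_cons.2 ⟨.inr ⟨j, rfl⟩, hL⟩
    · rw [List.prod_cons, mul_assoc]
      exact h1.colMove_mul j
    · rw [List.prod_cons, mul_assoc, h1.ofPerm_colMove_mul j, h2]

end FaceGrid

/-- **Upper bound on God's Number for the `n × n × 1` Rubik's Cube.**
There is a constant `C > 0` such that for every `n ≥ 2` and every `g ∈ G(n)`,
there is a sequence of at most `C · n² / log n` legal moves `m₁, …, m_k`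
with `c₀ ∘ (m_k ⋯ m₁ g)⁻¹ = c₀`. -/
theorem nxnx1_gods_number_upper_bound :
    ∃ C : ℝ, 0 < C ∧ ∀ n : ℕ, 2 ≤ n → ∀ g ∈ RGroup n,
      ∃ L : List (Equiv.Perm (RPos n)),
        (∀ m ∈ L, m ∈ RMoves n) ∧
        (L.length : ℝ) ≤ C * (n : ℝ) ^ 2 / Real.log n ∧
        solvedColoring n ∘ ⇑(L.prod * g)⁻¹ = solvedColoring n := by
  refine ⟨290, by norm_num, fun n hn g hg => ?_⟩
  obtain ⟨c, hc, hcard⟩ := exists_block_size hn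
  obtain ⟨htwo, hstd⟩ := FaceGrid.twoSided_and_isStandard_of_mem hg
  obtain ⟨L, hL, hlen, hside, hsolved⟩ :=
    (hstd.reaches_solved fun Z => RectDecomp.of_block_size Z hc).exists_moves htwo rfl
  refine ⟨L, hL, ?_, ?_⟩
  · generalize (n / c + 1) * (c * 2 ^ c + n) = K at hcard hlen
    have hn0 : (0 : ℝ) < n := by positivity
    have hlogpos : 0 < Real.log n := Real.log_pos (by exact_mod_cast hn)
    have hlin : (n : ℝ) ≤ (n : ℝ) ^ 2 / Real.log n := by
      rw [le_div_iff₀ hlogpos, sq]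
      exact mul_le_mul_of_nonneg_left (Real.log_le_self hn0.le) hn0.le
    have hlen' : (L.length : ℝ) ≤ 2 * n + 24 * K := by exact_mod_cast hlen
    rw [mul_div_assoc] at hcard ⊢
    linarith
  · funext ⟨x, y, b⟩
    have h : FaceGrid.ofPerm (L.prod * g) x y = true := by rw [hsolved]
    cases b
    · exact (hside x y).trans (by rw [h]; rfl)
    · exact h
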